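/- arXiv:math/0304164 — 3 statements merged into one kernel-verified Lean document; each statement's English description precedes it below -/
import Mathlib

section
/- In a coaugmented k-coalgebra C, the δ-filtration satisfies D_0 = k·1̲ and, for every n ≥ 1, the recursion D_n = Δ^{−1}( C ⊗ D_{n−1} + D_0 ⊗ C ); equivalently, D_n is the (n+1)-fold wedge power ∧^{n+1}(k·1̲), where X ∧ Y := Δ^{−1}(C ⊗ Y + X ⊗ C). (Lemma 2.8(a)) -/
open TensorProduct PiTensorProduct

noncomputable section

namespace CDP

variable (k : Type) [Field k] (C : Type) [AddCommGroup C] [Module k C]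

/-- The canonical equivalence `⨂[k]^1 C ≃ C`. -/
def tpowOne : (⨂[k]^1 C) ≃ₗ[k] C := PiTensorProduct.subsingletonEquiv (0 : Fin 1)

/-- Splitting a tensor power. -/
def tpowSplit (a b : ℕ) : (⨂[k]^(a+b) C) ≃ₗ[k] (⨂[k]^a C) ⊗[k] (⨂[k]^b C) :=
  (PiTensorProduct.reindex k (fun _ : Fin (a+b) => C) finSumFinEquiv.symm).trans
    (PiTensorProduct.tmulEquiv k C).symm

/-- Prepending a tensor factor. -/
def consTP (n : ℕ) : C ⊗[k] (⨂[k]^n C) →ₗ[k] ⨂[k]^(n+1) C :=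
  (PiTensorProduct.reindex k (fun _ : Fin (1+n) => C)
      (finCongr (Nat.add_comm 1 n))).toLinearMap ∘ₗ
    (tpowSplit k C 1 n).symm.toLinearMap ∘ₗ
    (TensorProduct.map (tpowOne k C).symm.toLinearMap LinearMap.id)

variable {C} in
/-- The iterated comultiplication `Δ^n : C → C^{⊗ n}`, with `Δ^0 := ε`. -/
def DeltaIter (comul : C →ₗ[k] C ⊗[k] C) (counit : C →ₗ[k] k) :
    (n : ℕ) → (C →ₗ[k] ⨂[k]^n C)
  | 0 => (PiTensorProduct.isEmptyEquiv (Fin 0)).symm.toLinearMap ∘ₗ counit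
  | n+1 => consTP k C n ∘ₗ
      (TensorProduct.map LinearMap.id (DeltaIter comul counit n)) ∘ₗ comul

variable {C} in
/-- The projection `id - u ∘ ε` associated to the coaugmentation `one = u(1)`. -/
def proj (counit : C →ₗ[k] k) (one : C) : C →ₗ[k] C :=
  LinearMap.id - (LinearMap.toSpanSingleton k C one) ∘ₗ counit

variable {C} in
/-- Drinfeld's maps `δ_n := (id - u∘ε)^{⊗n} ∘ Δ^n`. -/
def deltaN (comul : C →ₗ[k] C ⊗[k] C) (counit : C →ₗ[k] k) (one : C) (n : ℕ) :
    C →ₗ[k] ⨂[k]^n C :=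
  (PiTensorProduct.map fun _ : Fin n => proj k counit one) ∘ₗ DeltaIter k comul counit n

variable {C} in
/-- The `δ`-filtration `D_n := ker δ_{n+1}`. -/
def Dfil (comul : C →ₗ[k] C ⊗[k] C) (counit : C →ₗ[k] k) (one : C) (n : ℕ) :
    Submodule k C :=
  LinearMap.ker (deltaN k comul counit one (n+1))

/-- For subspaces `X, Y ⊆ C`, the subspace `X ⊗ Y ⊆ C ⊗ C`. -/
def tsub (X Y : Submodule k C) : Submodule k (C ⊗[k] C) :=
  LinearMap.range (TensorProduct.map X.subtype Y.subtype)

variable {C} in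
/-- The wedge product `X ∧ Y := Δ^{-1}(C ⊗ Y + X ⊗ C)` of two subspaces. -/
def wedge (comul : C →ₗ[k] C ⊗[k] C) (X Y : Submodule k C) : Submodule k C :=
  Submodule.comap comul (tsub k C ⊤ Y ⊔ tsub k C X ⊤)

variable {C} in
/-- Iterated wedge powers: `wedgePow X n = ∧^{n+1} X`, i.e.
`wedgePow X 0 = ∧^1 X = X` and `wedgePow X (n+1) = (∧^{n+1} X) ∧ X`. -/
def wedgePow (comul : C →ₗ[k] C ⊗[k] C) (X : Submodule k C) : ℕ → Submodule k C
  | 0 => X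
  | n+1 => wedge k comul (wedgePow comul X n) X

end CDP

open CDP

namespace CDP

theorem wedge_ker (k : Type) [Field k] {C : Type} [AddCommGroup C] [Module k C]
    (comul : C →ₗ[k] C ⊗[k] C) {M N : Type} [AddCommGroup M] [Module k M]
    [AddCommGroup N] [Module k N] (f : C →ₗ[k] M) (g : C →ₗ[k] N) :
    wedge k comul (LinearMap.ker f) (LinearMap.ker g) =
      LinearMap.ker (TensorProduct.map f g ∘ₗ comul) := by
  have key : tsub k C ⊤ (LinearMap.ker g) ⊔ tsub k C (LinearMap.ker f) ⊤ =
      LinearMap.ker (TensorProduct.map f g) := by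
    have h1 : TensorProduct.map f g =
        TensorProduct.map (LinearMap.range f).subtype (LinearMap.range g).subtype ∘ₗ
        TensorProduct.map f.rangeRestrict g.rangeRestrict := by
      rw [← TensorProduct.map_comp]; rfl
    have hinj : Function.Injective
        (TensorProduct.map (LinearMap.range f).subtype (LinearMap.range g).subtype) :=
      TensorProduct.map_injective_of_flat_flat _ _
        (Submodule.subtype_injective _) (Submodule.subtype_injective _)
    rw [h1, LinearMap.ker_comp_of_ker_eq_bot _ (LinearMap.ker_eq_bot.2 hinj)]
    rw [TensorProduct.map_ker (f := (LinearMap.ker f).subtype)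
      (f' := (LinearMap.ker g).subtype) (g := f.rangeRestrict) (g' := g.rangeRestrict)
      (by rw [LinearMap.exact_iff]; simp) f.surjective_rangeRestrict
      (by rw [LinearMap.exact_iff]; simp) g.surjective_rangeRestrict]
    congr 1
    · unfold tsub
      apply le_antisymm
      · rintro _ ⟨x, rfl⟩
        induction x with
        | zero => simp
        | add x y hx hy => rw [map_add]; exact add_mem hx hy
        | tmul x y => exact ⟨(x : C) ⊗ₜ y, rfl⟩
      · rintro _ ⟨x, rfl⟩
        induction x with
        | zero => simp
        | add x y hx hy => rw [map_add]; exact add_mem hx hy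
        | tmul x y => exact ⟨(⟨x, trivial⟩ : (⊤ : Submodule k C)) ⊗ₜ y, rfl⟩
    · unfold tsub
      apply le_antisymm
      · rintro _ ⟨x, rfl⟩
        induction x with
        | zero => simp
        | add x y hx hy => rw [map_add]; exact add_mem hx hy
        | tmul x y => exact ⟨x ⊗ₜ (y : C), rfl⟩
      · rintro _ ⟨x, rfl⟩
        induction x with
        | zero => simp
        | add x y hx hy => rw [map_add]; exact add_mem hx hy
        | tmul x y => exact ⟨x ⊗ₜ (⟨y, trivial⟩ : (⊤ : Submodule k C)), rfl⟩
  rw [wedge, key, LinearMap.ker_comp]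

theorem wedge_assoc (k : Type) [Field k] {C : Type} [AddCommGroup C] [Module k C]
    [Coalgebra k C] (X Y Z : Submodule k C) :
    wedge k Coalgebra.comul (wedge k Coalgebra.comul X Y) Z =
      wedge k Coalgebra.comul X (wedge k Coalgebra.comul Y Z) := by
  have hX := X.ker_mkQ
  have hY := Y.ker_mkQ
  have hZ := Z.ker_mkQ
  generalize X.mkQ = f at hX
  generalize Y.mkQ = g at hY
  generalize Z.mkQ = h at hZ
  rw [← hX, ← hY, ← hZ]
  simp only [wedge_ker]
  have e : TensorProduct.map f (TensorProduct.map g h ∘ₗ Coalgebra.comul) ∘ₗ Coalgebra.comul =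
      (TensorProduct.assoc k _ _ _).toLinearMap ∘ₗ
      TensorProduct.map (TensorProduct.map f g ∘ₗ Coalgebra.comul) h ∘ₗ Coalgebra.comul := by
    have e1 : TensorProduct.map f (TensorProduct.map g h ∘ₗ Coalgebra.comul (R := k) (A := C)) =
        TensorProduct.map f (TensorProduct.map g h) ∘ₗ
          LinearMap.lTensor C (Coalgebra.comul (R := k) (A := C)) := by
      rw [LinearMap.lTensor, ← TensorProduct.map_comp]; rfl
    have e2 : TensorProduct.map (TensorProduct.map f g ∘ₗ Coalgebra.comul (R := k) (A := C)) h =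
        TensorProduct.map (TensorProduct.map f g) h ∘ₗ
          LinearMap.rTensor C (Coalgebra.comul (R := k) (A := C)) := by
      rw [LinearMap.rTensor, ← TensorProduct.map_comp]; rfl
    have e3 : TensorProduct.map f (TensorProduct.map g h) ∘ₗ
        (TensorProduct.assoc k C C C).toLinearMap =
        (TensorProduct.assoc k _ _ _).toLinearMap ∘ₗ
        TensorProduct.map (TensorProduct.map f g) h := by
      ext; rfl
    rw [e1, e2, LinearMap.comp_assoc, ← Coalgebra.coassoc, ← LinearMap.comp_assoc, e3]
    rfl
  rw [e, LinearMap.ker_comp_of_ker_eq_bot _ (LinearEquiv.ker _)]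

theorem consTP_injective (k : Type) [Field k] (C : Type) [AddCommGroup C] [Module k C]
    (n : ℕ) : Function.Injective (consTP k C n) := by
  unfold consTP
  have h : (TensorProduct.map (tpowOne k C).symm.toLinearMap
      (LinearMap.id : (⨂[k]^n C) →ₗ[k] (⨂[k]^n C))) =
      (TensorProduct.congr (tpowOne k C).symm (LinearEquiv.refl k _)).toLinearMap := rfl
  rw [h]
  simp only [LinearMap.coe_comp, LinearEquiv.coe_coe]
  exact (LinearEquiv.injective _).comp ((LinearEquiv.injective _).comp (LinearEquiv.injective _))

theorem map_consTP (k : Type) [Field k] (C : Type) [AddCommGroup C] [Module k C]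
    (n : ℕ) (P : C →ₗ[k] C) :
    (PiTensorProduct.map fun _ : Fin (n+1) => P) ∘ₗ consTP k C n =
      consTP k C n ∘ₗ TensorProduct.map P (PiTensorProduct.map fun _ : Fin n => P) := by
  have hc : ∀ (c : C) (v : Fin n → C), consTP k C n (c ⊗ₜ PiTensorProduct.tprod k v) =
      PiTensorProduct.tprod k (fun i => Sum.elim (fun _ : Fin 1 => c) v
        (finSumFinEquiv.symm ((finCongr (Nat.add_comm 1 n)).symm i))) := by
    intro c v
    have h1 : (tpowOne k C).symm c = PiTensorProduct.tprod k (fun _ => c) := by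
      rw [LinearEquiv.symm_apply_eq]; simp [tpowOne]
    have h2 : (tpowSplit k C 1 n).symm
        (PiTensorProduct.tprod k (fun _ : Fin 1 => c) ⊗ₜ PiTensorProduct.tprod k v) =
        PiTensorProduct.tprod k (fun i : Fin (1+n) =>
          Sum.elim (fun _ : Fin 1 => c) v (finSumFinEquiv.symm i)) := by
      rw [LinearEquiv.symm_apply_eq, tpowSplit, LinearEquiv.trans_apply,
        LinearEquiv.eq_symm_apply, PiTensorProduct.tmulEquiv_apply]
      refine Eq.trans ?_ (PiTensorProduct.reindex_tprod (R := k) (s := fun _ : Fin (1+n) => C)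
        finSumFinEquiv.symm _).symm
      congr 1
      funext i
      simp
    have h3 : consTP k C n (c ⊗ₜ PiTensorProduct.tprod k v) =
        PiTensorProduct.reindex k (fun _ : Fin (1+n) => C) (finCongr (Nat.add_comm 1 n))
          ((tpowSplit k C 1 n).symm ((tpowOne k C).symm c ⊗ₜ PiTensorProduct.tprod k v)) := rfl
    rw [h3, h1, h2]
    exact PiTensorProduct.reindex_tprod (R := k) (s := fun _ : Fin (1+n) => C) _ _
  ext c v
  simp only [TensorProduct.AlgebraTensorModule.curry_apply, LinearMap.compMultilinearMap_apply,
    TensorProduct.curry_apply, LinearMap.comp_apply, LinearMap.restrictScalars_apply,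
    TensorProduct.map_tmul, hc, PiTensorProduct.map_tprod]
  congr 1
  funext i
  generalize (finSumFinEquiv.symm ((finCongr (Nat.add_comm 1 n)).symm i)) = s
  cases s <;> rfl

theorem deltaN_succ (k : Type) [Field k] {C : Type} [AddCommGroup C] [Module k C]
    (comul : C →ₗ[k] C ⊗[k] C) (counit : C →ₗ[k] k) (one : C) (n : ℕ) :
    deltaN k comul counit one (n+1) = consTP k C n ∘ₗ
      TensorProduct.map (proj k counit one) (deltaN k comul counit one n) ∘ₗ comul := by
  rw [deltaN, DeltaIter, ← LinearMap.comp_assoc, map_consTP, LinearMap.comp_assoc,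
    ← LinearMap.comp_assoc comul, ← TensorProduct.map_comp]
  rfl

theorem ker_deltaN_succ (k : Type) [Field k] {C : Type} [AddCommGroup C] [Module k C]
    (comul : C →ₗ[k] C ⊗[k] C) (counit : C →ₗ[k] k) (one : C) (n : ℕ) :
    LinearMap.ker (deltaN k comul counit one (n+1)) =
      wedge k comul (LinearMap.ker (proj k counit one))
        (LinearMap.ker (deltaN k comul counit one n)) := by
  rw [deltaN_succ, LinearMap.ker_comp_of_ker_eq_bot _ (LinearMap.ker_eq_bot.2
    (consTP_injective k C n)), wedge_ker]

theorem ker_proj (k : Type) [Field k] {C : Type} [AddCommGroup C] [Module k C]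
    (counit : C →ₗ[k] k) (one : C) (h : counit one = 1) :
    LinearMap.ker (proj k counit one) = Submodule.span k {one} := by
  ext x
  rw [LinearMap.mem_ker, Submodule.mem_span_singleton]
  simp only [proj, LinearMap.sub_apply, LinearMap.id_apply, LinearMap.comp_apply,
    LinearMap.toSpanSingleton_apply, sub_eq_zero]
  constructor
  · intro hx; exact ⟨_, hx.symm⟩
  · rintro ⟨a, rfl⟩; simp [h]

theorem Dfil_zero (k : Type) [Field k] {C : Type} [AddCommGroup C] [Module k C]
    [Coalgebra k C] (one : C) (h : Coalgebra.counit one = (1 : k)) :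
    Dfil k Coalgebra.comul Coalgebra.counit one 0 = Submodule.span k {one} := by
  rw [← ker_proj k _ one h, Dfil, ker_deltaN_succ, wedge_ker]
  have h0 : LinearMap.ker (deltaN k (Coalgebra.comul (R := k) (A := C)) Coalgebra.counit one 0) =
      LinearMap.ker (Coalgebra.counit (R := k) (A := C)) := by
    have : deltaN k (Coalgebra.comul (R := k) (A := C)) Coalgebra.counit one 0 =
        (PiTensorProduct.isEmptyEquiv (Fin 0)).symm.toLinearMap ∘ₗ Coalgebra.counit := by
      rw [deltaN, DeltaIter, ← LinearMap.comp_assoc]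
      congr 1
      ext
      simp only [PiTensorProduct.isEmptyEquiv]
      simp
      congr 1
      funext i
      exact i.elim0
    rw [this, LinearMap.ker_comp_of_ker_eq_bot _ (LinearEquiv.ker _)]
  rw [← wedge_ker, h0, wedge_ker]
  have e : TensorProduct.map (proj k Coalgebra.counit one) (Coalgebra.counit (R := k) (A := C)) ∘ₗ
      Coalgebra.comul = (TensorProduct.rid k C).symm.toLinearMap ∘ₗ
        proj k Coalgebra.counit one := by
    have e1 : TensorProduct.map (proj k Coalgebra.counit one)
        (Coalgebra.counit (R := k) (A := C)) =
        LinearMap.rTensor k (proj k Coalgebra.counit one) ∘ₗ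
          LinearMap.lTensor C Coalgebra.counit := by
      rw [LinearMap.rTensor_comp_lTensor]
    rw [e1, LinearMap.comp_assoc, Coalgebra.lTensor_counit_comp_comul]
    ext x
    simp
  rw [e, LinearMap.ker_comp_of_ker_eq_bot _ (LinearEquiv.ker _)]

theorem wedgePow_succ' (k : Type) [Field k] {C : Type} [AddCommGroup C] [Module k C]
    [Coalgebra k C] (X : Submodule k C) (n : ℕ) :
    wedgePow k Coalgebra.comul X (n+1) =
      wedge k Coalgebra.comul X (wedgePow k Coalgebra.comul X n) := by
  induction n with
  | zero => rfl
  | succ n ih =>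
    rw [wedgePow, ih, wedge_assoc, ← ih]
    rfl

end CDP

/-- **Lemma 2.8(a).** In a coaugmented `k`-coalgebra `C`, the `δ`-filtration
satisfies `D_0 = k·1̲` and, for every `n ≥ 1`, the recursion
`D_n = Δ^{−1}(C ⊗ D_{n−1} + D_0 ⊗ C)`; equivalently `D_n` is the `(n+1)`-fold
wedge power `∧^{n+1}(k·1̲)`, where `X ∧ Y := Δ^{−1}(C ⊗ Y + X ⊗ C)`. -/
theorem delta_filtration_wedge
    (k : Type) [Field k] (C : Type) [AddCommGroup C] [Module k C] [Coalgebra k C]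
    (one : C) (hcomul : Coalgebra.comul one = one ⊗ₜ[k] one)
    (hcounit : Coalgebra.counit one = (1 : k)) :
    Dfil k Coalgebra.comul Coalgebra.counit one 0 = Submodule.span k {one} ∧
    (∀ n : ℕ,
      Dfil k Coalgebra.comul Coalgebra.counit one (n+1) =
        Submodule.comap (Coalgebra.comul : C →ₗ[k] C ⊗[k] C)
          (tsub k C ⊤ (Dfil k Coalgebra.comul Coalgebra.counit one n) ⊔
            tsub k C (Dfil k Coalgebra.comul Coalgebra.counit one 0) ⊤)) ∧
    (∀ n : ℕ,
      Dfil k Coalgebra.comul Coalgebra.counit one n =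
        wedgePow k Coalgebra.comul (Submodule.span k {one}) n) := by
  have h0 := Dfil_zero k one hcounit
  have hs : ∀ n : ℕ, Dfil k Coalgebra.comul Coalgebra.counit one (n+1) =
      wedge k Coalgebra.comul (Submodule.span k {one})
        (Dfil k Coalgebra.comul Coalgebra.counit one n) := by
    intro n
    rw [Dfil, ker_deltaN_succ, ker_proj k _ one hcounit]
    rfl
  refine ⟨h0, ?_, ?_⟩
  · intro n
    rw [h0, hs]
    rfl
  · intro n
    induction n with
    | zero => exact h0
    | succ n ih => rw [hs, ih, wedgePow_succ']
end
end

section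
/- Let B be a bialgebra over a field k, and for n ∈ ℕ set D_n := ker δ_{n+1}, with D_{−1} := 0. If a ∈ D_r and b ∈ D_s (r, s ∈ ℕ), then the commutator ab − ba lies in D_{r+s−1}; equivalently δ_{r+s}(ab − ba) = 0. Consequently the associated graded algebra gr_D(B) := ⊕_{n∈ℕ} D_n/D_{n−1} is commutative. (Theorem 3.5(b), commutativity part) -/
open TensorProduct PiTensorProduct

noncomputable section

open CDP


namespace CDPaux

theorem consTP_tmul (k : Type) [Field k] (C : Type) [AddCommGroup C] [Module k C] (n : ℕ)
    (x : C) (v : Fin n → C) :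
    consTP k C n (x ⊗ₜ tprod k v) = tprod k (Fin.cons x v : Fin (n + 1) → C) := by
  have h1 : (tpowOne k C).symm x = tprod k (fun _ => x) := by
    rw [LinearEquiv.symm_apply_eq]
    simp [tpowOne]
  simp only [consTP, LinearMap.comp_apply, TensorProduct.map_tmul, LinearEquiv.coe_coe, h1,
    LinearMap.id_apply, tpowSplit, LinearEquiv.trans_symm, LinearEquiv.trans_apply,
    LinearEquiv.symm_symm, tmulEquiv_apply, reindex_symm]
  erw [reindex_tprod, reindex_tprod]
  congr 1
  funext i
  refine Fin.cases ?_ (fun j => ?_) i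
  · have : (finSumFinEquiv.symm ((finCongr (Nat.add_comm 1 n)).symm 0) : Fin 1 ⊕ Fin n)
        = Sum.inl 0 := by
      rw [Equiv.symm_apply_eq]; ext; simp
    erw [this]
    rfl
  · have : (finSumFinEquiv.symm ((finCongr (Nat.add_comm 1 n)).symm j.succ) : Fin 1 ⊕ Fin n)
        = Sum.inr j := by
      rw [Equiv.symm_apply_eq]; ext; simp [Nat.add_comm]
    erw [this]
    rfl

theorem consTP_leftInv (k : Type) [Field k] (C : Type) [AddCommGroup C] [Module k C] (n : ℕ) :
    ∃ G : (⨂[k]^(n+1) C) →ₗ[k] C ⊗[k] (⨂[k]^n C), G ∘ₗ consTP k C n = LinearMap.id := by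
  refine ⟨(TensorProduct.map (tpowOne k C).toLinearMap LinearMap.id) ∘ₗ
    (tpowSplit k C 1 n).toLinearMap ∘ₗ
    (PiTensorProduct.reindex k (fun _ : Fin (1+n) => C)
      (finCongr (Nat.add_comm 1 n))).symm.toLinearMap, ?_⟩
  apply LinearMap.ext
  intro x
  simp only [consTP, LinearMap.comp_apply, LinearEquiv.coe_coe, LinearEquiv.symm_apply_apply,
    LinearEquiv.apply_symm_apply, LinearMap.id_apply]
  rw [← LinearMap.comp_apply, ← TensorProduct.map_comp]
  simp

theorem map_consTP (k : Type) [Field k] (C : Type) [AddCommGroup C] [Module k C] (n : ℕ)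
    (f : Fin (n+1) → (C →ₗ[k] C)) :
    (PiTensorProduct.map f) ∘ₗ consTP k C n =
      consTP k C n ∘ₗ TensorProduct.map (f 0) (PiTensorProduct.map (fun i => f i.succ)) := by
  apply TensorProduct.ext
  apply LinearMap.ext
  intro x
  apply PiTensorProduct.ext
  apply MultilinearMap.ext
  intro v
  change PiTensorProduct.map f (consTP k C n (x ⊗ₜ PiTensorProduct.tprod k v)) =
    consTP k C n (TensorProduct.map (f 0) (PiTensorProduct.map (fun i => f i.succ))
      (x ⊗ₜ PiTensorProduct.tprod k v))
  rw [TensorProduct.map_tmul, map_tprod, consTP_tmul, consTP_tmul, map_tprod]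
  congr 1
  funext i
  refine Fin.cases ?_ (fun j => ?_) i <;> simp

section
variable (k : Type) [Field k] (B : Type) [Ring B] [Bialgebra k B]

abbrev cm : B →ₗ[k] B ⊗[k] B := Coalgebra.comul
abbrev cu : B →ₗ[k] k := Coalgebra.counit
abbrev pp : B →ₗ[k] B := proj k (cu k B) (1 : B)
abbrev ee : B →ₗ[k] B := (LinearMap.toSpanSingleton k B 1) ∘ₗ (cu k B)
abbrev dl (n : ℕ) : B →ₗ[k] ⨂[k]^n B := deltaN k (cm k B) (cu k B) (1 : B) n
abbrev DI (n : ℕ) : B →ₗ[k] ⨂[k]^n B := DeltaIter k (cm k B) (cu k B) n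

theorem pp_apply (x : B) : pp k B x = x - Coalgebra.counit (R := k) x • (1 : B) := by
  simp [proj]

theorem ee_apply (x : B) : ee k B x = Coalgebra.counit (R := k) x • (1 : B) := by
  simp

theorem pp_one : pp k B 1 = 0 := by
  simp [proj]

theorem map_DI_succ (n : ℕ) (f : Fin (n+1) → (B →ₗ[k] B)) :
    PiTensorProduct.map f ∘ₗ DI k B (n+1) =
      consTP k B n ∘ₗ TensorProduct.map (f 0)
        (PiTensorProduct.map (fun i => f i.succ) ∘ₗ DI k B n) ∘ₗ cm k B := by
  rw [DI, DeltaIter, ← LinearMap.comp_assoc, map_consTP, LinearMap.comp_assoc,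
    ← LinearMap.comp_assoc (cm k B), ← TensorProduct.map_comp, LinearMap.comp_id]

theorem dl_succ (n : ℕ) :
    dl k B (n+1) = consTP k B n ∘ₗ TensorProduct.map (pp k B) (dl k B n) ∘ₗ cm k B :=
  map_DI_succ k B n (fun _ => pp k B)

/-- If `F` factors through `δ_m` then `cons (p ⊗ F) Δ` factors through `δ_{m+1}`. -/
theorem factor_step (n m : ℕ) (Φ : (⨂[k]^m B) →ₗ[k] ⨂[k]^n B) :
    ∃ Ψ : (⨂[k]^(m+1) B) →ₗ[k] ⨂[k]^(n+1) B,
      consTP k B n ∘ₗ TensorProduct.map (pp k B) (Φ ∘ₗ dl k B m) ∘ₗ cm k B =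
        Ψ ∘ₗ dl k B (m+1) := by
  obtain ⟨G, hG⟩ := consTP_leftInv k B m
  refine ⟨consTP k B n ∘ₗ TensorProduct.map LinearMap.id Φ ∘ₗ G, ?_⟩
  rw [dl_succ]
  have h2 : TensorProduct.map (pp k B) (Φ ∘ₗ dl k B m) =
      TensorProduct.map LinearMap.id Φ ∘ₗ TensorProduct.map (pp k B) (dl k B m) := by
    rw [← TensorProduct.map_comp, LinearMap.id_comp]
  rw [h2]
  apply LinearMap.ext
  intro x
  have h3 := fun y => LinearMap.congr_fun hG y
  simp only [LinearMap.comp_apply, LinearMap.id_apply] at h3 ⊢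
  rw [h3]

theorem map_ee_comul (N : Type) [AddCommGroup N] [Module k N] (F : B →ₗ[k] N) :
    TensorProduct.map (ee k B) F ∘ₗ cm k B = (TensorProduct.mk k B N 1) ∘ₗ F := by
  have h : TensorProduct.map (ee k B) F =
      TensorProduct.map (LinearMap.toSpanSingleton k B 1) F ∘ₗ
        (LinearMap.rTensor B (cu k B)) := by
    rw [LinearMap.rTensor, ← TensorProduct.map_comp, LinearMap.comp_id]
  rw [h]
  apply LinearMap.ext
  intro x
  simp only [LinearMap.comp_apply]
  rw [Coalgebra.rTensor_counit_comul]
  simp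

abbrev QQ (n : ℕ) (g : Fin n → Bool) : (⨂[k]^n B) →ₗ[k] ⨂[k]^n B :=
  PiTensorProduct.map (fun i => bif g i then pp k B else ee k B)

theorem factor_card (n : ℕ) : ∀ (g : Fin n → Bool) (m : ℕ),
    (Finset.univ.filter (fun i => g i = true)).card = m →
    ∃ Φ : (⨂[k]^m B) →ₗ[k] ⨂[k]^n B, QQ k B n g ∘ₗ DI k B n = Φ ∘ₗ dl k B m := by
  induction n with
  | zero =>
    intro g m hm
    obtain rfl : m = 0 := by rw [← hm]; simp
    refine ⟨LinearMap.id, ?_⟩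
    have h : (fun i => bif g i then pp k B else ee k B) = fun _ => pp k B := by
      funext i; exact i.elim0
    rw [LinearMap.id_comp, QQ, h]
    rfl
  | succ n ih =>
    intro g m hm
    rw [Fin.card_filter_univ_succ] at hm
    have key := map_DI_succ k B n (fun i => bif g i then pp k B else ee k B)
    cases h0 : g 0
    · simp only [h0] at hm key
      obtain ⟨Φ, hΦ⟩ := ih (fun i => g i.succ) m (by simpa using hm)
      refine ⟨consTP k B n ∘ₗ TensorProduct.mk k B _ 1 ∘ₗ Φ, ?_⟩
      refine key.trans ?_
      simp only [cond_false]
      rw [map_ee_comul]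
      rw [hΦ]
      rfl
    · simp only [h0, if_true] at hm key
      obtain ⟨m, rfl⟩ : ∃ m', m = m' + 1 := ⟨_, hm.symm⟩
      obtain ⟨Φ, hΦ⟩ := ih (fun i => g i.succ) m (by simpa using hm)
      obtain ⟨Ψ, hΨ⟩ := factor_step k B n m Φ
      refine ⟨Ψ, ?_⟩
      rw [← hΨ, ← hΦ]
      exact key

theorem dl_zero : dl k B 0 = (PiTensorProduct.isEmptyEquiv (Fin 0)).symm.toLinearMap ∘ₗ cu k B := by
  rw [dl, deltaN, DeltaIter]
  apply LinearMap.ext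
  intro x
  simp only [LinearMap.comp_apply]
  have : (fun _ : Fin 0 => pp k B) = fun _ => LinearMap.id := by
    funext i; exact i.elim0
  rw [this, PiTensorProduct.map_id]
  rfl

theorem dl_one (x : B) : dl k B 1 x = tprod k (fun _ => pp k B x) := by
  have h : TensorProduct.map (pp k B) (dl k B 0) =
      TensorProduct.map (pp k B) (PiTensorProduct.isEmptyEquiv (Fin 0)).symm.toLinearMap ∘ₗ
        (LinearMap.lTensor B (cu k B)) := by
    rw [LinearMap.lTensor, ← TensorProduct.map_comp, LinearMap.comp_id, dl_zero]
  rw [dl_succ, h]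
  simp only [LinearMap.comp_apply]
  rw [Coalgebra.lTensor_counit_comul, TensorProduct.map_tmul]
  have h2 : (PiTensorProduct.isEmptyEquiv (Fin 0)).symm.toLinearMap (1 : k) =
      tprod k (fun i : Fin 0 => (i.elim0 : B)) := by
    change (1 : k) • PiTensorProduct.tprod k _ = _
    rw [one_smul]
    congr 1
  rw [h2, consTP_tmul]
  congr 1
  funext i
  refine Fin.cases ?_ (fun j => j.elim0) i
  simp

theorem factor_dl (m : ℕ) : ∃ Φ : (⨂[k]^(m+1) B) →ₗ[k] ⨂[k]^(m+2) B,
    dl k B (m+2) = Φ ∘ₗ dl k B (m+1) := by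
  induction m with
  | zero =>
    have h1 : tpowOne k B ∘ₗ dl k B 1 = pp k B := by
      apply LinearMap.ext
      intro x
      simp only [LinearMap.comp_apply, dl_one]
      simp [tpowOne]
    refine ⟨dl k B 2 ∘ₗ (tpowOne k B).toLinearMap, ?_⟩
    rw [LinearMap.comp_assoc]
    refine Eq.trans ?_ (congrArg (fun t => dl k B 2 ∘ₗ t) h1.symm)
    apply LinearMap.ext
    intro x
    have h2 : dl k B 2 1 = 0 := by
      rw [dl_succ]
      simp only [LinearMap.comp_apply]
      rw [Bialgebra.comul_one, Algebra.TensorProduct.one_def, TensorProduct.map_tmul, pp_one]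
      simp
    simp only [LinearMap.comp_apply]
    rw [pp_apply, map_sub, map_smul, h2]
    simp
  | succ m ih =>
    obtain ⟨Φ, hΦ⟩ := ih
    obtain ⟨Ψ, hΨ⟩ := factor_step k B (m+2) (m+1) Φ
    refine ⟨Ψ, ?_⟩
    rw [← hΨ, ← hΦ, ← dl_succ]

theorem dl_vanish (a : B) (r : ℕ) (ha : dl k B (r+1) a = 0) (m : ℕ) (hm : r + 1 ≤ m) :
    dl k B m a = 0 := by
  induction m, hm using Nat.le_induction with
  | base => exact ha
  | succ m hm ih =>
    obtain ⟨m, rfl⟩ : ∃ m', m = m' + 1 := ⟨m - 1, by omega⟩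
    obtain ⟨Φ, hΦ⟩ := factor_dl k B m
    rw [hΦ, LinearMap.comp_apply, ih, map_zero]

theorem QQ_vanish (a : B) (r : ℕ) (ha : dl k B (r+1) a = 0) (n : ℕ) (g : Fin n → Bool)
    (hg : r + 1 ≤ (Finset.univ.filter (fun i => g i = true)).card) :
    QQ k B n g (DI k B n a) = 0 := by
  obtain ⟨Φ, hΦ⟩ := factor_card k B n g _ rfl
  rw [← LinearMap.comp_apply, hΦ, LinearMap.comp_apply, dl_vanish k B a r ha _ hg, map_zero]

theorem consTP_mul (n : ℕ) (x y : B ⊗[k] (⨂[k]^n B)) :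
    consTP k B n (x * y) = consTP k B n x * consTP k B n y := by
  induction x using TensorProduct.induction_on with
  | zero => simp
  | add x x' hx hx' => rw [add_mul, map_add, hx, hx', map_add, add_mul]
  | tmul x v =>
  induction y using TensorProduct.induction_on with
  | zero => simp
  | add x x' hx hx' => rw [mul_add, map_add, hx, hx', map_add, mul_add]
  | tmul y w =>
  rw [Algebra.TensorProduct.tmul_mul_tmul]
  induction v using PiTensorProduct.induction_on with
  | add v v' h h' => simp only [add_mul, TensorProduct.tmul_add, map_add, h, h']
  | smul_tprod c v =>
  induction w using PiTensorProduct.induction_on with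
  | add v v' h h' => simp only [mul_add, TensorProduct.tmul_add, map_add, h, h']
  | smul_tprod d w =>
  simp only [smul_mul_smul_comm, TensorProduct.tmul_smul, map_smul, consTP_tmul, tprod_mul_tprod]
  congr 2
  funext i
  refine Fin.cases ?_ (fun j => ?_) i <;> simp

theorem DI_mul (n : ℕ) : ∀ a b : B, DI k B n (a * b) = DI k B n a * DI k B n b := by
  induction n with
  | zero =>
    intro a b
    simp only [DI, DeltaIter, LinearMap.comp_apply]
    rw [Bialgebra.counit_mul]
    have h2 : ∀ c : k, (PiTensorProduct.isEmptyEquiv (Fin 0)).symm.toLinearMap c =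
        c • PiTensorProduct.tprod k (fun i : Fin 0 => (i.elim0 : B)) := by
      intro c
      change c • PiTensorProduct.tprod k _ = _
      congr 2
    rw [h2, h2, h2]
    rw [smul_mul_smul_comm, tprod_mul_tprod]
    congr 2
    funext i; exact i.elim0
  | succ n ih =>
    intro a b
    have h : ∀ x y : B ⊗[k] B, TensorProduct.map LinearMap.id (DI k B n) (x * y) =
        TensorProduct.map LinearMap.id (DI k B n) x *
          TensorProduct.map LinearMap.id (DI k B n) y := by
      intro x y
      induction x using TensorProduct.induction_on with
      | zero => simp
      | add x x' hx hx' => rw [add_mul, map_add, hx, hx', map_add, add_mul]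
      | tmul x v =>
      induction y using TensorProduct.induction_on with
      | zero => simp
      | add x x' hx hx' => rw [mul_add, map_add, hx, hx', map_add, mul_add]
      | tmul y w =>
      simp only [Algebra.TensorProduct.tmul_mul_tmul, TensorProduct.map_tmul, LinearMap.id_apply,
        ih]
    rw [DI, DeltaIter]
    simp only [LinearMap.comp_apply]
    rw [Bialgebra.comul_mul]
    erw [h]
    exact consTP_mul k B n _ _

theorem QQ_sum (n : ℕ) (x : ⨂[k]^n B) :
    x = ∑ S : Finset (Fin n), QQ k B n (fun i => decide (i ∈ S)) x := by
  have h := (PiTensorProduct.mapMultilinear k (fun _ : Fin n => B) (fun _ => B)).map_add_univ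
    (fun _ => pp k B) (fun _ => ee k B)
  have h2 : ((fun _ => pp k B) + (fun _ => ee k B) : Fin n → (B →ₗ[k] B)) =
      fun _ => LinearMap.id := by
    funext i
    simp [proj]
  rw [h2] at h
  have h3 := LinearMap.congr_fun h x
  simp only [mapMultilinear_apply, PiTensorProduct.map_id, LinearMap.sum_apply,
    LinearMap.id_apply] at h3
  refine h3.trans (Finset.sum_congr rfl fun S _ => ?_)
  congr 2
  funext i
  by_cases hi : i ∈ S <;> simp [hi]

theorem bil_ind (n : ℕ) (F : (⨂[k]^n B) →ₗ[k] (⨂[k]^n B) →ₗ[k] (⨂[k]^n B))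
    (h : ∀ v w : Fin n → B, F (tprod k v) (tprod k w) = 0) (x y : ⨂[k]^n B) : F x y = 0 := by
  induction x using PiTensorProduct.induction_on with
  | add v v' h h' => rw [map_add, LinearMap.add_apply, h, h', add_zero]
  | smul_tprod c v =>
  induction y using PiTensorProduct.induction_on with
  | add v v' h h' => rw [map_add, h, h', add_zero]
  | smul_tprod d w => simp [h]

theorem QQ_comm (n : ℕ) (g g' : Fin n → Bool) (h : ∀ i, g i = false ∨ g' i = false)
    (x y : ⨂[k]^n B) : QQ k B n g x * QQ k B n g' y = QQ k B n g' y * QQ k B n g x := by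
  have := bil_ind k B n
    ((LinearMap.mul k (⨂[k]^n B)).compl₁₂ (QQ k B n g) (QQ k B n g') -
      (LinearMap.mul k (⨂[k]^n B)).flip.compl₁₂ (QQ k B n g) (QQ k B n g')) ?_ x y
  · simpa [sub_eq_zero] using this
  · intro v w
    simp only [LinearMap.sub_apply, LinearMap.compl₁₂_apply, LinearMap.flip_apply,
      LinearMap.mul_apply', map_tprod, tprod_mul_tprod, sub_eq_zero]
    congr 1
    funext i
    rcases h i with h | h <;> simp [h]

theorem QQ_kill (n : ℕ) (g g' : Fin n → Bool) (i : Fin n) (h : g i = false) (h' : g' i = false)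
    (x y : ⨂[k]^n B) :
    PiTensorProduct.map (fun _ => pp k B) (QQ k B n g x * QQ k B n g' y) = 0 := by
  have := bil_ind k B n
    (((LinearMap.mul k (⨂[k]^n B)).compl₁₂ (QQ k B n g) (QQ k B n g')).compr₂
      (PiTensorProduct.map (fun _ => pp k B))) ?_ x y
  · simpa using this
  · intro v w
    simp only [LinearMap.compr₂_apply, LinearMap.compl₁₂_apply,
      LinearMap.mul_apply', map_tprod, tprod_mul_tprod]
    apply MultilinearMap.map_coord_zero _ i
    simp [h, h', proj]

theorem main (r s : ℕ) (a b : B) (ha : dl k B (r+1) a = 0) (hb : dl k B (s+1) b = 0) :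
    dl k B (r+s) (a * b - b * a) = 0 := by
  set n := r + s with hn
  set x := DI k B n a with hx
  set y := DI k B n b with hy
  have h0 : dl k B n (a * b - b * a) =
      PiTensorProduct.map (fun _ => pp k B) (x * y - y * x) := by
    rw [hx, hy, ← DI_mul, ← DI_mul, ← map_sub]
    rfl
  rw [h0]
  have h1 : x * y - y * x = ∑ S : Finset (Fin n), ∑ T : Finset (Fin n),
      (QQ k B n (fun i => decide (i ∈ S)) x * QQ k B n (fun i => decide (i ∈ T)) y -
        QQ k B n (fun i => decide (i ∈ T)) y * QQ k B n (fun i => decide (i ∈ S)) x) := by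
    simp only [Finset.sum_sub_distrib]
    rw [Finset.sum_comm (f := fun S T => QQ k B n (fun i => decide (i ∈ T)) y * _)]
    simp only [← Finset.mul_sum, ← Finset.sum_mul]
    rw [← QQ_sum, ← QQ_sum]
  rw [h1, map_sum]
  refine Finset.sum_eq_zero fun S _ => ?_
  rw [map_sum]
  refine Finset.sum_eq_zero fun T _ => ?_
  by_cases hS : r + 1 ≤ S.card
  · rw [hx, QQ_vanish k B a r ha n _ (by simpa using hS)]
    simp
  by_cases hT : s + 1 ≤ T.card
  · rw [hy, QQ_vanish k B b s hb n _ (by simpa using hT)]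
    simp
  by_cases hST : S ∪ T = Finset.univ
  · have hd : Disjoint S T := by
      rw [← Finset.card_union_eq_card_add_card]
      have h2 := Finset.card_union_le S T
      rw [hST, Finset.card_univ, Fintype.card_fin] at h2 ⊢
      omega
    rw [QQ_comm, sub_self, map_zero]
    intro i
    by_cases hi : i ∈ S
    · right
      simpa using Finset.disjoint_left.mp hd hi
    · left
      simpa using hi
  · obtain ⟨i, hi⟩ : ∃ i, i ∉ S ∪ T := by
      by_contra hc
      push Not at hc
      exact hST (Finset.eq_univ_of_forall hc)
    rw [Finset.mem_union, not_or] at hi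
    rw [map_sub, QQ_kill k B n _ _ i (by simpa using hi.1) (by simpa using hi.2),
      QQ_kill k B n _ _ i (by simpa using hi.2) (by simpa using hi.1), sub_zero]

theorem main_zero (a b : B) (ha : dl k B 1 a = 0) : a * b - b * a = 0 := by
  have h : pp k B a = 0 := by
    have h1 := congrArg (tpowOne k B) ha
    rw [dl_one] at h1
    simpa [tpowOne] using h1
  rw [pp_apply, sub_eq_zero] at h
  rw [h]
  simp

end

end CDPaux

/-- **Theorem 3.5(b), commutativity part.** Let `B` be a bialgebra over a
field `k`, and for `n ∈ ℕ` set `D_n := ker δ_{n+1}`, with `D_{−1} := 0`.  If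
`a ∈ D_r` and `b ∈ D_s` (`r, s ∈ ℕ`), then the commutator `ab − ba` lies in
`D_{r+s−1}`; equivalently `δ_{r+s}(ab − ba) = 0`.  (When `r + s = 0` this
means `ab − ba = 0`.)  Consequently the associated graded algebra
`gr_D(B) = ⊕_n D_n/D_{n−1}` is commutative. -/
theorem commutator_in_lower_delta_filtration
    (k : Type) [Field k] (B : Type) [Ring B] [Bialgebra k B] :
    ∀ (r s : ℕ) (a b : B),
      a ∈ Dfil k Coalgebra.comul Coalgebra.counit (1 : B) r →
      b ∈ Dfil k Coalgebra.comul Coalgebra.counit (1 : B) s →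
      deltaN k Coalgebra.comul Coalgebra.counit (1 : B) (r + s) (a * b - b * a) = 0 ∧
      (∀ m : ℕ, r + s = m + 1 →
        a * b - b * a ∈ Dfil k Coalgebra.comul Coalgebra.counit (1 : B) m) ∧
      (r + s = 0 → a * b - b * a = 0) := by
  intro r s a b ha hb
  have h := CDPaux.main k B r s a b ha hb
  refine ⟨h, ?_, ?_⟩
  · intro m hm
    rw [hm] at h
    exact h
  · intro h0
    obtain rfl : r = 0 := by omega
    exact CDPaux.main_zero k B a b ha
end
end

section
/- Let B be a bialgebra over a field k with char k = p > 0, and for n ∈ ℕ set D_n := ker δ_{n+1}. If b ∈ D_ℓ with ℓ ≥ 1, then b^p ∈ D_{pℓ−1}, i.e. δ_{pℓ}(b^p) = 0. Consequently, in the commutative graded algebra gr_D(B) := ⊕_{n∈ℕ} D_n/D_{n−1}, the p-th power of every homogeneous element of positive degree is zero. (Theorem 3.5(b), characteristic p part) -/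
open TensorProduct PiTensorProduct

noncomputable section

namespace CDPProof

open CDP

/-! ### Combinatorial part -/

theorem cyc_sum {X A : Type} [Fintype X] [AddCommGroup A] (p : ℕ) (hp : p.Prime)
    (hA : ∀ a : A, p • a = 0) (F : (Fin p → X) → A)
    (hperm : ∀ (σ : Equiv.Perm (Fin p)) f, F (f ∘ σ) = F f)
    (hconst : ∀ x, F (fun _ => x) = 0) : ∑ f, F f = 0 := by
  classical
  obtain ⟨q, rfl⟩ : ∃ q, p = q + 1 := ⟨p - 1, by have := hp.pos; omega⟩
  have : Fact (q + 1).Prime := ⟨hp⟩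
  rw [Finset.sum_comp (fun a : A => a) F]
  refine Finset.sum_eq_zero fun a _ => ?_
  by_cases ha : a = 0
  · simp [ha]
  have key : ∀ (g : Fin (q + 1)) (f : Fin (q + 1) → X), F (fun x => f (x + g)) = F f :=
    fun g f => hperm (Equiv.addRight g) f
  let act : MulAction (Multiplicative (ZMod (q + 1))) {f : Fin (q + 1) → X // F f = a} :=
    { smul := fun g f => ⟨fun x => f.1 (x + (show Fin (q + 1) from g.toAdd)), by
        rw [key]; exact f.2⟩
      one_smul := fun f => Subtype.ext (funext fun x => congrArg f.1 (add_zero x))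
      mul_smul := fun g h f => Subtype.ext (funext fun x => congrArg f.1 (by
        change x + ((show Fin (q + 1) from g.toAdd) + (show Fin (q + 1) from h.toAdd)) = _
        exact (add_assoc _ _ _).symm)) }
  have hG : IsPGroup (q + 1) (Multiplicative (ZMod (q + 1))) :=
    IsPGroup.of_card (n := 1) (by simp)
  have h1 := hG.card_modEq_card_fixedPoints {f : Fin (q + 1) → X // F f = a}
  have h2 : IsEmpty (MulAction.fixedPoints (Multiplicative (ZMod (q + 1)))
      {f : Fin (q + 1) → X // F f = a}) := by
    constructor
    rintro ⟨f, hf⟩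
    apply ha
    rw [← f.2, ← hconst (f.1 0)]
    congr 1
    funext x
    have := congrArg (fun t => t.1 0) (hf (Multiplicative.ofAdd (show ZMod (q + 1) from x)))
    change f.1 (0 + x) = _ at this
    rwa [zero_add] at this
  rw [Nat.card_of_isEmpty (α := MulAction.fixedPoints _ _), Nat.modEq_zero_iff_dvd,
    Nat.card_eq_fintype_card, Fintype.card_subtype] at h1
  obtain ⟨c, hc⟩ := h1
  rw [hc, mul_comm, mul_smul, hA, smul_zero]

theorem comb {A : Type} [Ring A] (p : ℕ) (hp : p.Prime) (hA : ∀ a : A, p • a = 0)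
    (ℓ n : ℕ) (hℓ : 1 ≤ ℓ) (hn : n = p * ℓ)
    (x : A) (X : Finset (Fin n) → A) (hx : x = ∑ S, X S)
    (P : A →+ A) (e : Fin n → A →+* A)
    (hP : ∀ i y, e i y = y → P y = 0)
    (he : ∀ i S, i ∉ S → e i (X S) = X S)
    (hX : ∀ S, ℓ < S.card → X S = 0)
    (hcomm : ∀ S T, Disjoint S T → Commute (X S) (X T)) : P (x ^ p) = 0 := by
  classical
  let F : (Fin p → Finset (Fin n)) → A := fun f => P (List.ofFn fun i => X (f i)).prod
  have hexp : P (x ^ p) = ∑ f, F f := by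
    rw [← MultilinearMap.mkPiAlgebraFin_apply_const (R := ℤ), hx, MultilinearMap.map_sum, map_sum]
    simp [F, MultilinearMap.mkPiAlgebraFin_apply]
  -- nonzero terms come from ordered partitions
  have hsmall : ∀ f i, ℓ < (f i).card → F f = 0 := by
    intro f i h
    have : (List.ofFn fun i => X (f i)).prod = 0 :=
      List.prod_eq_zero (by rw [List.mem_ofFn]; exact ⟨i, hX _ h⟩)
    simp [F, this]
  have hcover : ∀ f j, (∀ i, j ∉ f i) → F f = 0 := by
    intro f j h
    apply hP j
    rw [map_list_prod, List.map_ofFn]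
    congr 2
    funext i
    exact he j _ (h i)
  have hdisj : ∀ f, F f ≠ 0 → ∀ i j, i ≠ j → Disjoint (f i) (f j) := by
    intro f hf i j hij
    have hs : ∀ i, (f i).card ≤ ℓ := fun i => by
      by_contra h; exact hf (hsmall f i (by omega))
    have hu : (Finset.univ : Finset (Fin p)).biUnion f = Finset.univ := by
      ext a
      simp only [Finset.mem_biUnion, Finset.mem_univ, true_and, iff_true]
      by_contra h; push Not at h; exact hf (hcover f a h)
    by_contra hd
    rw [Finset.not_disjoint_iff] at hd
    obtain ⟨a, hai, haj⟩ := hd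
    have hu' : (Finset.univ : Finset (Fin p)).biUnion (fun t => if t = i then (f t).erase a else f t)
        = Finset.univ := by
      ext b
      simp only [Finset.mem_biUnion, Finset.mem_univ, true_and, iff_true]
      by_cases hb : b = a
      · exact ⟨j, by rw [if_neg (Ne.symm hij), hb]; exact haj⟩
      · have : b ∈ (Finset.univ : Finset (Fin p)).biUnion f := by rw [hu]; simp
        obtain ⟨t, -, ht⟩ := Finset.mem_biUnion.1 this
        refine ⟨t, ?_⟩
        split_ifs
        · exact Finset.mem_erase.2 ⟨hb, ht⟩
        · exact ht
    have h1 := Finset.card_biUnion_le (s := (Finset.univ : Finset (Fin p)))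
      (t := fun t => if t = i then (f t).erase a else f t)
    rw [hu', Finset.card_univ, Fintype.card_fin] at h1
    have h2 : ∑ t, (if t = i then (f t).erase a else f t).card < ∑ t : Fin p, ℓ := by
      refine Finset.sum_lt_sum (fun t _ => ?_) ⟨i, Finset.mem_univ _, ?_⟩
      · split_ifs
        · exact (Finset.card_erase_le).trans (hs t)
        · exact hs t
      · rw [if_pos rfl]
        exact (Finset.card_erase_lt_of_mem hai).trans_le (hs i)
    simp at h2
    omega
  have hperm1 : ∀ (σ : Equiv.Perm (Fin p)) f, F f ≠ 0 → F (f ∘ σ) = F f := by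
    intro σ f hf
    have hd := hdisj f hf
    have h : (List.ofFn ((fun i => X (f i)) ∘ σ)).Perm (List.ofFn fun i => X (f i)) :=
      σ.ofFn_comp_perm _
    change P _ = P _
    congr 1
    refine h.prod_eq' ?_
    rw [List.pairwise_ofFn]
    intro i j hij
    exact hcomm _ _ (hd _ _ (by simpa using hij.ne))
  rw [hexp]
  refine cyc_sum p hp hA F ?_ ?_
  · intro σ f
    by_cases hf : F f = 0
    · by_contra h
      rw [hf] at h
      have := hperm1 σ⁻¹ _ h
      rw [← this] at h
      apply h
      rw [← hf]
      congr 1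
      funext x
      simp
    · exact hperm1 σ f hf
  · intro S
    by_contra h
    have hd := hdisj _ h ⟨0, hp.pos⟩ ⟨1, hp.one_lt⟩ (by simp)
    simp only [disjoint_self, Finset.bot_eq_empty] at hd
    subst hd
    have : 0 < n := by rw [hn]; exact Nat.mul_pos hp.pos hℓ
    exact h (hcover _ ⟨0, this⟩ (by simp))

/-! ### Tensor part -/

variable {k : Type} [Field k]

section lin
variable {C : Type} [AddCommGroup C] [Module k C]

theorem consTP_tmul (n : ℕ) (a : C) (v : Fin n → C) :
    consTP k C n (a ⊗ₜ tprod k v) = tprod k (Fin.cons a v : Fin (n + 1) → C) := by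
  have h1 : (tpowOne k C).symm a = tprod k (fun _ : Fin 1 => a) :=
    subsingletonEquiv_symm_apply' _ _
  simp only [consTP, tpowSplit, LinearMap.comp_apply, TensorProduct.map_tmul, LinearEquiv.coe_coe,
    h1, LinearMap.id_apply, LinearEquiv.trans_symm, LinearEquiv.symm_symm, LinearEquiv.trans_apply]
  rw [tmulEquiv_apply]
  have h2 : (reindex k (fun _ : Fin (1 + n) => C) finSumFinEquiv.symm).symm
      (tprod k fun i => Sum.elim (fun _ : Fin 1 => a) v i) =
      tprod k (fun i => Sum.elim (fun _ : Fin 1 => a) v (finSumFinEquiv.symm i)) := by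
    rw [LinearEquiv.symm_apply_eq]
    erw [reindex_tprod]
    simp
  erw [h2, reindex_tprod]
  congr 1
  funext i
  refine Fin.cases ?_ (fun i => ?_) i
  · have : (finCongr (Nat.add_comm 1 n)).symm 0 = Fin.castAdd n (0 : Fin 1) := by ext; simp
    rw [this, finSumFinEquiv_symm_apply_castAdd]; simp
  · have : (finCongr (Nat.add_comm 1 n)).symm i.succ = Fin.natAdd 1 i := by
      ext; simp [add_comm]
    rw [this, finSumFinEquiv_symm_apply_natAdd]; simp

theorem consTP_leftInv (n : ℕ) : ∃ c : (⨂[k]^(n+1) C) →ₗ[k] C ⊗[k] (⨂[k]^n C),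
    ∀ y, c (consTP k C n y) = y := by
  refine ⟨(TensorProduct.map (tpowOne k C).toLinearMap LinearMap.id) ∘ₗ
    (tpowSplit k C 1 n).toLinearMap ∘ₗ
    (PiTensorProduct.reindex k (fun _ : Fin (1+n) => C)
      (finCongr (Nat.add_comm 1 n))).symm.toLinearMap, fun y => ?_⟩
  simp only [consTP, LinearMap.comp_apply, LinearEquiv.coe_coe, LinearEquiv.symm_apply_apply,
    LinearEquiv.apply_symm_apply]
  induction y with
  | zero => simp
  | add x y hx hy => simp only [map_add, hx, hy]
  | tmul x y => simp

theorem map_consTP (n : ℕ) (φ : Fin (n + 1) → C →ₗ[k] C) (y : C ⊗[k] (⨂[k]^n C)) :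
    PiTensorProduct.map φ (consTP k C n y) =
      consTP k C n (TensorProduct.map (φ 0) (PiTensorProduct.map fun i => φ i.succ) y) := by
  induction y with
  | zero => simp
  | add x y hx hy => simp only [map_add, hx, hy]
  | tmul a t =>
    induction t using PiTensorProduct.induction_on with
    | smul_tprod r v =>
      simp only [TensorProduct.tmul_smul, map_smul, consTP_tmul, map_tprod, TensorProduct.map_tmul]
      congr 2
      funext i
      refine Fin.cases ?_ (fun i => ?_) i <;> simp
    | add x y hx hy => simp only [TensorProduct.tmul_add, map_add, hx, hy]

end lin

section bialg
variable {B : Type} [Ring B] [Bialgebra k B]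

variable (k B) in
/-- The iterated comultiplication of `B`. -/
abbrev Dl (n : ℕ) : B →ₗ[k] ⨂[k]^n B := DeltaIter k Coalgebra.comul Coalgebra.counit n

variable (k B) in
/-- The projection to the augmentation ideal. -/
abbrev pr : B →ₗ[k] B := proj k Coalgebra.counit (1 : B)

variable (k B) in
/-- The map `u ∘ ε`. -/
abbrev ue : B →ₗ[k] B := (LinearMap.toSpanSingleton k B 1) ∘ₗ Coalgebra.counit

variable (k B) in
/-- Drinfeld's map. -/
abbrev dl (n : ℕ) : B →ₗ[k] ⨂[k]^n B := deltaN k Coalgebra.comul Coalgebra.counit (1 : B) n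

theorem ue_apply (b : B) : ue k B b = algebraMap k B (Coalgebra.counit b) := by
  simp [ue, Algebra.algebraMap_eq_smul_one]

theorem ue_mul (a b : B) : ue k B (a * b) = ue k B a * ue k B b := by
  simp only [ue_apply, Bialgebra.counit_mul, map_mul]

theorem ue_one : ue k B 1 = 1 := by
  simp only [ue_apply, Bialgebra.counit_one, map_one]

theorem ue_ue (a : B) : ue k B (ue k B a) = ue k B a := by
  simp [ue_apply]

theorem pr_apply (b : B) : pr k B b = b - ue k B b := rfl

theorem pr_ue (a : B) : pr k B (ue k B a) = 0 := by
  rw [pr_apply, ue_ue, sub_self]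

theorem pr_one : pr k B 1 = 0 := by
  rw [pr_apply, ue_one, sub_self]

theorem tp_mul_ind {n : ℕ} {Q : (⨂[k]^n B) → (⨂[k]^n B) → Prop}
    (h0 : ∀ v w, Q (tprod k v) (tprod k w))
    (hs1 : ∀ (r : k) x y, Q x y → Q (r • x) y) (hs2 : ∀ (r : k) x y, Q x y → Q x (r • y))
    (ha1 : ∀ x x' y, Q x y → Q x' y → Q (x + x') y)
    (ha2 : ∀ x y y', Q x y → Q x y' → Q x (y + y')) (x y) : Q x y := by
  induction x using PiTensorProduct.induction_on with
  | smul_tprod r v =>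
    apply hs1
    induction y using PiTensorProduct.induction_on with
    | smul_tprod r w => exact hs2 _ _ _ (h0 v w)
    | add y y' h h' => exact ha2 _ _ _ h h'
  | add x x' h h' => exact ha1 _ _ _ h h'

theorem map_mul' {n : ℕ} (φ : Fin n → B →ₗ[k] B) (h : ∀ i a b, φ i (a * b) = φ i a * φ i b)
    (x y : ⨂[k]^n B) : PiTensorProduct.map φ (x * y) =
      PiTensorProduct.map φ x * PiTensorProduct.map φ y := by
  refine tp_mul_ind (Q := fun x y => PiTensorProduct.map φ (x * y) =
      PiTensorProduct.map φ x * PiTensorProduct.map φ y) ?_ ?_ ?_ ?_ ?_ x y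
  · intro v w
    simp only [tprod_mul_tprod, map_tprod]
    congr 1
    funext i
    exact h i _ _
  · intro r x y hh; rw [smul_mul_assoc, map_smul, hh, map_smul, smul_mul_assoc]
  · intro r x y hh; rw [mul_smul_comm, map_smul, hh, map_smul, mul_smul_comm]
  · intro x x' y h1 h2; rw [add_mul, map_add, h1, h2, map_add, add_mul]
  · intro x x' y h1 h2; rw [mul_add, map_add, h1, h2, map_add, mul_add]

theorem map_commute {n : ℕ} (φ ψ : Fin n → B →ₗ[k] B) (h : ∀ i a b, Commute (φ i a) (ψ i b))
    (x y : ⨂[k]^n B) : Commute (PiTensorProduct.map φ x) (PiTensorProduct.map ψ y) := by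
  refine tp_mul_ind (Q := fun x y => Commute (PiTensorProduct.map φ x)
    (PiTensorProduct.map ψ y)) ?_ ?_ ?_ ?_ ?_ x y
  · intro v w
    simp only [map_tprod]
    exact Commute.tprod (funext fun i => h i _ _)
  · intro r x y hh; rw [map_smul]; exact hh.smul_left r
  · intro r x y hh; rw [map_smul]; exact hh.smul_right r
  · intro x x' y h1 h2; rw [map_add]; exact h1.add_left h2
  · intro x x' y h1 h2; rw [map_add]; exact h1.add_right h2

theorem consTP_mul (n : ℕ) (a b : B) (s t : ⨂[k]^n B) :
    consTP k B n ((a * b) ⊗ₜ (s * t)) = consTP k B n (a ⊗ₜ s) * consTP k B n (b ⊗ₜ t) := by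
  refine tp_mul_ind (Q := fun s t => consTP k B n ((a * b) ⊗ₜ (s * t)) =
    consTP k B n (a ⊗ₜ s) * consTP k B n (b ⊗ₜ t)) ?_ ?_ ?_ ?_ ?_ s t
  · intro v w
    simp only [tprod_mul_tprod, consTP_tmul]
    congr 1
    funext i
    refine Fin.cases ?_ (fun i => ?_) i <;> simp
  · intro r x y hh; simp only [smul_mul_assoc, TensorProduct.tmul_smul, map_smul, hh]
  · intro r x y hh; simp only [mul_smul_comm, TensorProduct.tmul_smul, map_smul, hh]
  · intro x x' y h1 h2; simp only [add_mul, TensorProduct.tmul_add, map_add, h1, h2]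
  · intro x x' y h1 h2; simp only [mul_add, TensorProduct.tmul_add, map_add, h1, h2]

theorem Dl_succ (n : ℕ) (b : B) : Dl k B (n + 1) b =
    consTP k B n (TensorProduct.map LinearMap.id (Dl k B n) (Coalgebra.comul b)) := rfl

theorem Dl_zero (b : B) : Dl k B 0 b =
    (PiTensorProduct.isEmptyEquiv (Fin 0)).symm (Coalgebra.counit b) := rfl

theorem Dl_one (n : ℕ) : Dl k B n 1 = 1 := by
  induction n with
  | zero =>
    rw [Dl_zero, Bialgebra.counit_one, LinearEquiv.symm_apply_eq, one_def,
      isEmptyEquiv_apply_tprod]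
  | succ n ih =>
    rw [Dl_succ, Bialgebra.comul_one, Algebra.TensorProduct.one_def, TensorProduct.map_tmul, ih,
      one_def, one_def]
    erw [consTP_tmul]
    congr 1
    funext i
    refine Fin.cases ?_ (fun i => ?_) i <;> simp

theorem Dl_mul (n : ℕ) (a b : B) : Dl k B n (a * b) = Dl k B n a * Dl k B n b := by
  induction n generalizing a b with
  | zero =>
    have h : ∀ r : k, (PiTensorProduct.isEmptyEquiv (R := k) (s := fun _ => B) (Fin 0)).symm r =
        r • (1 : ⨂[k]^0 B) := fun r => by
      rw [LinearEquiv.symm_apply_eq, map_smul, one_def, isEmptyEquiv_apply_tprod]; simp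
    simp only [Dl_zero, h, Bialgebra.counit_mul]
    simp [mul_smul, smul_mul_assoc]
    rw [smul_comm]
  | succ n ih =>
    rw [Dl_succ, Dl_succ, Dl_succ, Bialgebra.comul_mul]
    generalize (Coalgebra.comul a : B ⊗[k] B) = x
    generalize (Coalgebra.comul b : B ⊗[k] B) = y
    induction x with
    | zero => simp
    | add x x' h h' => simp only [add_mul, map_add, h, h']
    | tmul c d =>
      induction y with
      | zero => simp
      | add x x' h h' => simp only [mul_add, map_add, h, h']
      | tmul e f =>
        simp only [Algebra.TensorProduct.tmul_mul_tmul, TensorProduct.map_tmul, ih,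
          LinearMap.id_apply]
        exact consTP_mul _ _ _ _ _

theorem Dl_pow (n m : ℕ) (b : B) : Dl k B n (b ^ m) = Dl k B n b ^ m := by
  induction m with
  | zero => rw [pow_zero, pow_zero, Dl_one]
  | succ m ih => rw [pow_succ, Dl_mul, ih, pow_succ]

theorem map_Dl_succ (n : ℕ) (φ : Fin (n + 1) → B →ₗ[k] B) (b : B) :
    PiTensorProduct.map φ (Dl k B (n + 1) b) = consTP k B n (TensorProduct.map (φ 0)
      (PiTensorProduct.map (fun i => φ i.succ) ∘ₗ Dl k B n) (Coalgebra.comul b)) := by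
  rw [Dl_succ, map_consTP, ← LinearMap.comp_apply (TensorProduct.map _ _), ← TensorProduct.map_comp,
    LinearMap.comp_id]

theorem dl_succ (n : ℕ) (b : B) : dl k B (n + 1) b = consTP k B n
    (TensorProduct.map (pr k B) (dl k B n) (Coalgebra.comul b)) :=
  map_Dl_succ n _ b

theorem counit_aux {M : Type} [AddCommGroup M] [Module k M] (f : B →ₗ[k] M) (b : B) :
    TensorProduct.map (ue k B) f (Coalgebra.comul b) = 1 ⊗ₜ[k] f b := by
  have h : TensorProduct.map (ue k B) f = TensorProduct.map (LinearMap.toSpanSingleton k B 1) f ∘ₗ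
      (Coalgebra.counit (R := k) (A := B)).rTensor B := by
    rw [LinearMap.rTensor, ← TensorProduct.map_comp, LinearMap.comp_id]
  rw [h, LinearMap.comp_apply, Coalgebra.rTensor_counit_comul]
  simp

theorem counit_aux' (n : ℕ) (b : B) : TensorProduct.map (pr k B) (dl k B 0) (Coalgebra.comul b) =
    pr k B b ⊗ₜ[k] ((PiTensorProduct.isEmptyEquiv (Fin 0)).symm 1) := by
  have h0 : dl k B 0 = (PiTensorProduct.isEmptyEquiv (Fin 0)).symm.toLinearMap ∘ₗ
      Coalgebra.counit := by
    have : (PiTensorProduct.map fun _ : Fin 0 => pr k B) = LinearMap.id := by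
      rw [← PiTensorProduct.map_id]; congr 1; funext i; exact i.elim0
    rw [dl, deltaN, this]; rfl
  have h : TensorProduct.map (pr k B) (dl k B 0) = TensorProduct.map (pr k B)
      (PiTensorProduct.isEmptyEquiv (Fin 0)).symm.toLinearMap ∘ₗ
      (Coalgebra.counit (R := k) (A := B)).lTensor B := by
    rw [LinearMap.lTensor, ← TensorProduct.map_comp, LinearMap.comp_id, h0]
  rw [h, LinearMap.comp_apply, Coalgebra.lTensor_counit_comul]
  simp

theorem map_id_comp {M N : Type} [AddCommGroup M] [Module k M] [AddCommGroup N] [Module k N]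
    (φ : B →ₗ[k] B) (f : B →ₗ[k] M) (g : M →ₗ[k] N) (y : B ⊗[k] B) :
    TensorProduct.map φ (g ∘ₗ f) y =
      TensorProduct.map LinearMap.id g (TensorProduct.map φ f y) := by
  rw [← LinearMap.comp_apply (TensorProduct.map _ _), ← TensorProduct.map_comp, LinearMap.id_comp]

theorem dl_factor (m : ℕ) : ∃ h : (⨂[k]^(m+1) B) →ₗ[k] ⨂[k]^(m+2) B,
    dl k B (m + 2) = h ∘ₗ dl k B (m + 1) := by
  induction m with
  | zero =>
    obtain ⟨c, hc⟩ := consTP_leftInv (k := k) (C := B) 0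
    refine ⟨dl k B 2 ∘ₗ (TensorProduct.rid k B).toLinearMap ∘ₗ
      TensorProduct.map LinearMap.id (PiTensorProduct.isEmptyEquiv (Fin 0)).toLinearMap ∘ₗ c, ?_⟩
    ext b
    simp only [LinearMap.comp_apply]
    rw [dl_succ 0, hc, counit_aux' 0]
    simp only [TensorProduct.map_tmul, LinearEquiv.coe_coe, LinearEquiv.apply_symm_apply,
      LinearMap.id_apply, TensorProduct.rid_tmul, one_smul]
    have h1 : dl k B 2 1 = 0 := by
      rw [dl_succ, Bialgebra.comul_one, Algebra.TensorProduct.one_def, TensorProduct.map_tmul,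
        pr_one, TensorProduct.zero_tmul, map_zero]
    rw [pr_apply, map_sub, ue_apply, Algebra.algebraMap_eq_smul_one, map_smul, h1, smul_zero,
      sub_zero]
  | succ m ih =>
    obtain ⟨h, hh⟩ := ih
    obtain ⟨c, hc⟩ := consTP_leftInv (k := k) (C := B) (m + 1)
    refine ⟨consTP k B (m + 2) ∘ₗ TensorProduct.map LinearMap.id h ∘ₗ c, ?_⟩
    ext b
    simp only [LinearMap.comp_apply]
    rw [dl_succ (m + 1), hc, dl_succ (m + 2), hh, map_id_comp]

theorem dl_mono (ℓ m : ℕ) (hm : ℓ < m) (b : B) (hb : dl k B (ℓ + 1) b = 0) : dl k B m b = 0 := by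
  induction m, hm using Nat.le_induction with
  | base => exact hb
  | succ m hm ih =>
    obtain ⟨m, rfl⟩ : ∃ q, m = q + 1 := ⟨m - 1, by omega⟩
    obtain ⟨h, hh⟩ := dl_factor (k := k) (B := B) m
    rw [hh, LinearMap.comp_apply, ih, map_zero]

variable (k B) in
/-- Choose `id - uε` or `uε`. -/
def ch (c : Prop) [Decidable c] : B →ₗ[k] B := if c then pr k B else ue k B

theorem part_factor (n : ℕ) (f : Fin n → Prop) [DecidablePred f] (m : ℕ)
    (hm : (Finset.univ.filter f).card = m) :
    ∃ j : (⨂[k]^m B) →ₗ[k] ⨂[k]^n B,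
      (PiTensorProduct.map fun i => ch k B (f i)) ∘ₗ Dl k B n = j ∘ₗ dl k B m := by
  induction n generalizing m with
  | zero =>
    obtain rfl : m = 0 := by rw [← hm]; simp
    refine ⟨LinearMap.id, ?_⟩
    rw [LinearMap.id_comp, dl, deltaN]
    congr 2
    funext i
    exact i.elim0
  | succ n ih =>
    obtain ⟨j, hj⟩ := ih (fun i => f i.succ) _ rfl
    rw [Fin.card_filter_univ_succ] at hm
    by_cases h0 : f 0
    · rw [if_pos h0] at hm
      subst hm
      obtain ⟨c, hc⟩ := consTP_leftInv (k := k) (C := B)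
        (Finset.univ.filter fun i : Fin n => f i.succ).card
      refine ⟨consTP k B n ∘ₗ TensorProduct.map LinearMap.id j ∘ₗ c, ?_⟩
      ext b
      simp only [LinearMap.comp_apply]
      erw [map_Dl_succ, hj, map_id_comp, dl_succ, hc]
      rw [ch, if_pos h0]
    · rw [if_neg h0] at hm
      subst hm
      refine ⟨consTP k B n ∘ₗ TensorProduct.mk k B _ 1 ∘ₗ j, ?_⟩
      ext b
      simp only [LinearMap.comp_apply]
      rw [map_Dl_succ, hj, ch, if_neg h0, counit_aux]
      rfl

theorem main (p : ℕ) (hp : p.Prime) (hchar : CharP k p) (ℓ : ℕ) (hℓ : 1 ≤ ℓ) (b : B)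
    (hb : dl k B (ℓ + 1) b = 0) : dl k B (p * ℓ) (b ^ p) = 0 := by
  classical
  let n := p * ℓ
  let X : Finset (Fin n) → ⨂[k]^n B := fun S =>
    PiTensorProduct.map (fun i => ch k B (i ∈ S)) (Dl k B n b)
  let ei : Fin n → Fin n → B →ₗ[k] B := fun i j => if j = i then ue k B else LinearMap.id
  have ei_mul : ∀ i j a b, ei i j (a * b) = ei i j a * ei i j b := by
    intro i j a b
    by_cases h : j = i
    · simp only [ei, if_pos h, ue_mul]
    · simp only [ei, if_neg h, LinearMap.id_apply]
  have ei_one : ∀ i j, ei i j 1 = 1 := by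
    intro i j
    by_cases h : j = i
    · simp only [ei, if_pos h, ue_one]
    · simp only [ei, if_neg h, LinearMap.id_apply]
  let e : Fin n → (⨂[k]^n B) →+* (⨂[k]^n B) := fun i =>
    { toFun := PiTensorProduct.map (ei i)
      map_one' := by
        rw [one_def, map_tprod]; congr 1; funext j; exact ei_one i j
      map_mul' := map_mul' _ (ei_mul i)
      map_zero' := map_zero _
      map_add' := map_add _ }
  change PiTensorProduct.map (fun _ => pr k B) (Dl k B n (b ^ p)) = 0
  rw [Dl_pow]
  refine comb p hp ?_ ℓ n hℓ rfl (Dl k B n b) X ?_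
    (PiTensorProduct.map fun _ => pr k B).toAddMonoidHom e ?_ ?_ ?_ ?_
  · intro a
    rw [← Nat.cast_smul_eq_nsmul k, CharP.cast_eq_zero, zero_smul]
  · have h := (PiTensorProduct.mapMultilinear k (fun _ : Fin n => B) (fun _ : Fin n => B)).map_add_univ
      (fun _ => pr k B) (fun _ => ue k B)
    have h' := congrArg (fun f => f (Dl k B n b)) h
    simp only [LinearMap.sum_apply, mapMultilinear_apply] at h'
    have hid : ((fun _ => pr k B) + (fun _ => ue k B) : Fin n → B →ₗ[k] B) =
        fun _ => LinearMap.id := by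
      funext i; ext b; simp [pr_apply]
    rw [hid, PiTensorProduct.map_id, LinearMap.id_apply] at h'
    rw [h']
    rfl
  · intro i y hy
    change PiTensorProduct.map (ei i) y = y at hy
    change PiTensorProduct.map (fun _ => pr k B) y = 0
    rw [← hy, ← LinearMap.comp_apply, ← PiTensorProduct.map_comp]
    have := (PiTensorProduct.mapMultilinear k (fun _ : Fin n => B) (fun _ : Fin n => B)).map_coord_zero
      (m := fun j => pr k B ∘ₗ ei i j) i (by
        ext b; simp only [ei, if_true]; exact pr_ue b)
    rw [mapMultilinear_apply] at this
    rw [this, LinearMap.zero_apply]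
  · intro i S hi
    change PiTensorProduct.map (ei i) (PiTensorProduct.map _ _) = PiTensorProduct.map _ _
    rw [← LinearMap.comp_apply, ← PiTensorProduct.map_comp]
    congr 2
    funext j
    by_cases h : j = i
    · subst h
      ext b
      simp only [ei, if_true, ch, if_neg hi]
      exact ue_ue b
    · simp only [ei, if_neg h, LinearMap.id_comp]
  · intro S hS
    obtain ⟨j, hj⟩ := part_factor (k := k) (B := B) n (fun i => i ∈ S) _ rfl
    have hj' := congrArg (fun f => f b) hj
    simp only [LinearMap.comp_apply] at hj'
    change PiTensorProduct.map _ _ = 0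
    rw [hj', dl_mono ℓ _ (by simpa using hS) b hb, map_zero]
  · intro S T hST
    refine map_commute _ _ (fun i a b => ?_) _ _
    by_cases hi : i ∈ S
    · have hT := Finset.disjoint_left.1 hST hi
      simp only [ch, if_neg hT, ue_apply]
      exact Algebra.commutes' _ _ |>.symm
    · simp only [ch, if_neg hi, ue_apply]
      exact Algebra.commutes' _ _

end bialg
end CDPProof


open CDP

/-- **Theorem 3.5(b), characteristic `p` part.** Let `B` be a bialgebra over a
field `k` with `char k = p > 0`, and for `n ∈ ℕ` set `D_n := ker δ_{n+1}`.
If `b ∈ D_ℓ` with `ℓ ≥ 1`, then `b^p ∈ D_{pℓ−1}`, i.e. `δ_{pℓ}(b^p) = 0`.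
Consequently, in the commutative graded algebra `gr_D(B) = ⊕_n D_n/D_{n−1}`,
the `p`-th power of every homogeneous element of positive degree is zero. -/
theorem pow_char_in_lower_delta_filtration
    (k : Type) [Field k] (B : Type) [Ring B] [Bialgebra k B]
    (p : ℕ) (hp : p.Prime) (hchar : CharP k p) :
    ∀ ℓ : ℕ, 1 ≤ ℓ → ∀ b : B,
      b ∈ Dfil k Coalgebra.comul Coalgebra.counit (1 : B) ℓ →
      b ^ p ∈ Dfil k Coalgebra.comul Coalgebra.counit (1 : B) (p * ℓ - 1) ∧
      deltaN k Coalgebra.comul Coalgebra.counit (1 : B) (p * ℓ) (b ^ p) = 0 := by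
  intro ℓ hℓ b hb
  have h := CDPProof.main (k := k) (B := B) p hp hchar ℓ hℓ b hb
  refine ⟨?_, h⟩
  have hpos : p * ℓ - 1 + 1 = p * ℓ := Nat.sub_add_cancel (Nat.mul_pos hp.pos hℓ)
  change deltaN k Coalgebra.comul Coalgebra.counit (1 : B) (p * ℓ - 1 + 1) (b ^ p) = 0
  rw [hpos]
  exact h
end
end
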